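/- Let n ≥ 1, let 0 ≤ k ≤ n, and let A ⊆ {0,1}^n be a set of 0–1 vectors each of weight exactly k (i.e., with exactly k coordinates equal to 1). If A is sunflower-free, then |A| ≤ Θ(C)^n / 2^{n−k}, where Θ(C) is the capset capacity. -/

import Mathlib

/-- The weight of a 0–1 vector: the number of coordinates equal to 1. -/
def weight {n : ℕ} (x : Fin n → Bool) : ℕ :=
  (Finset.univ.filter fun i => x i = true).card

/-- `A ⊆ {0,1}^n` is sunflower-free: it contains no three elements, not all equal,
such that in every coordinate the multiset of values is `{0,0,0}`, `{1,1,1}` or `{0,0,1}`. -/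
def SunflowerFree {n : ℕ} (A : Finset (Fin n → Bool)) : Prop :=
  ¬ ∃ x ∈ A, ∃ y ∈ A, ∃ z ∈ A, ¬ (x = y ∧ y = z) ∧
    ∀ i, ({x i, y i, z i} : Multiset Bool) = {false, false, false} ∨
         ({x i, y i, z i} : Multiset Bool) = {true, true, true} ∨
         ({x i, y i, z i} : Multiset Bool) = {false, false, true}

/-- A capset in `(ZMod 3)^n`: no three elements, not all equal, summing to zero. -/
def IsCapset {n : ℕ} (S : Finset (Fin n → ZMod 3)) : Prop :=
  ∀ x ∈ S, ∀ y ∈ S, ∀ z ∈ S, x + y + z = 0 → x = y ∧ y = z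

/-- `C_n`, the size of the largest capset in `(ZMod 3)^n`. -/
noncomputable def capsetMax (n : ℕ) : ℕ :=
  sSup {k | ∃ S : Finset (Fin n → ZMod 3), IsCapset S ∧ S.card = k}

/-- The capset capacity `Θ(C) = limsup (C_n)^(1/n)`. -/
noncomputable def capsetCapacity : ℝ :=
  Filter.limsup (fun n : ℕ => (capsetMax n : ℝ) ^ ((1 : ℝ) / n)) Filter.atTop

theorem bddAbove_capset_card (n : ℕ) :
    BddAbove {k | ∃ S : Finset (Fin n → ZMod 3), IsCapset S ∧ S.card = k} := by
  refine ⟨3 ^ n, ?_⟩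
  rintro _ ⟨S, -, rfl⟩
  simpa using S.card_le_univ

theorem IsCapset.card_le_capsetMax {n : ℕ} {S : Finset (Fin n → ZMod 3)} (hS : IsCapset S) :
    S.card ≤ capsetMax n :=
  le_csSup (bddAbove_capset_card n) ⟨S, hS, rfl⟩

theorem exists_isCapset_card_eq_capsetMax (n : ℕ) :
    ∃ S : Finset (Fin n → ZMod 3), IsCapset S ∧ S.card = capsetMax n :=
  Nat.sSup_mem (s := {k | ∃ S : Finset (Fin n → ZMod 3), IsCapset S ∧ S.card = k})
    ⟨0, ∅, by simp [IsCapset], rfl⟩ (bddAbove_capset_card n)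

theorem capsetMax_le (n : ℕ) : capsetMax n ≤ 3 ^ n := by
  obtain ⟨S, -, hS⟩ := exists_isCapset_card_eq_capsetMax n
  rw [← hS]
  simpa using S.card_le_univ

/-- Cutting a vector of length `m * n` into `m` blocks of length `n`. -/
def blockEquiv (m n : ℕ) : (Fin (m * n) → ZMod 3) ≃ (Fin m → Fin n → ZMod 3) :=
  (Equiv.arrowCongr finProdFinEquiv.symm (Equiv.refl _)).trans (Equiv.curry _ _ _)

theorem blockEquiv_add (m n : ℕ) (x y : Fin (m * n) → ZMod 3) :
    blockEquiv m n (x + y) = blockEquiv m n x + blockEquiv m n y := rfl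

theorem blockEquiv_zero (m n : ℕ) : blockEquiv m n 0 = 0 := rfl

/-- Powers of capsets are capsets, so `capsetMax` is supermultiplicative. -/
theorem capsetMax_pow_le (m n : ℕ) : capsetMax n ^ m ≤ capsetMax (m * n) := by
  obtain ⟨S, hS, hcard⟩ := exists_isCapset_card_eq_capsetMax n
  let T : Finset (Fin (m * n) → ZMod 3) :=
    (Fintype.piFinset fun _ : Fin m => S).map (blockEquiv m n).symm.toEmbedding
  have hmem : ∀ x, x ∈ T ↔ ∀ j, blockEquiv m n x j ∈ S := by
    intro x
    simp only [T, Finset.mem_map_equiv, Equiv.symm_symm, Fintype.mem_piFinset]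
  have hT : IsCapset T := by
    intro x hx y hy z hz h
    rw [hmem] at hx hy hz
    have hsum : blockEquiv m n x + blockEquiv m n y + blockEquiv m n z = 0 := by
      rw [← blockEquiv_add, ← blockEquiv_add, h, blockEquiv_zero]
    have key := fun j => hS _ (hx j) _ (hy j) _ (hz j) (congrFun hsum j)
    exact ⟨(blockEquiv m n).injective (funext fun j => (key j).1),
      (blockEquiv m n).injective (funext fun j => (key j).2)⟩
  have hTcard : T.card = capsetMax n ^ m := by
    simp [T, hcard]
  exact hTcard ▸ hT.card_le_capsetMax

theorem capsetMax_rpow_le_capsetCapacity {n : ℕ} (hn : 1 ≤ n) :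
    (capsetMax n : ℝ) ^ ((1 : ℝ) / n) ≤ capsetCapacity := by
  have hn0 : (n : ℝ) ≠ 0 := by positivity
  refine Filter.le_limsup_of_frequently_le ?_ ?_
  · rw [Filter.frequently_atTop]
    intro a
    refine ⟨(a + 1) * n, by nlinarith, ?_⟩
    have hpow : (capsetMax n : ℝ) ^ (a + 1) ≤ capsetMax ((a + 1) * n) := by
      exact_mod_cast capsetMax_pow_le (a + 1) n
    calc (capsetMax n : ℝ) ^ ((1 : ℝ) / n)
        = ((capsetMax n : ℝ) ^ (a + 1)) ^ ((1 : ℝ) / ((a + 1) * n : ℕ)) := by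
          rw [← Real.rpow_natCast, ← Real.rpow_mul (Nat.cast_nonneg _)]
          congr 1
          push_cast
          have : (a : ℝ) + 1 ≠ 0 := by positivity
          field_simp
      _ ≤ _ := Real.rpow_le_rpow (by positivity) hpow (by positivity)
  · refine Filter.isBoundedUnder_of_eventually_le (a := 3) ?_
    filter_upwards [Filter.eventually_ge_atTop 1] with N hN
    have hN0 : N ≠ 0 := by omega
    calc (capsetMax N : ℝ) ^ ((1 : ℝ) / N) ≤ ((3 : ℝ) ^ N) ^ ((1 : ℝ) / N) :=
          Real.rpow_le_rpow (by positivity) (by exact_mod_cast capsetMax_le N) (by positivity)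
      _ = 3 := by rw [one_div]; exact Real.pow_rpow_inv_natCast (by norm_num) hN0

theorem capsetMax_le_capsetCapacity_pow {n : ℕ} (hn : 1 ≤ n) :
    (capsetMax n : ℝ) ≤ capsetCapacity ^ n := by
  have hn0 : n ≠ 0 := by omega
  calc (capsetMax n : ℝ) = ((capsetMax n : ℝ) ^ ((1 : ℝ) / n)) ^ n := by
        rw [one_div, Real.rpow_inv_natCast_pow (Nat.cast_nonneg _) hn0]
    _ ≤ capsetCapacity ^ n :=
        pow_le_pow_left₀ (by positivity) (capsetMax_rpow_le_capsetCapacity hn) n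

/-- The indicator vector of the zero coordinates. -/
def zeroPattern {n : ℕ} (v : Fin n → ZMod 3) : Fin n → Bool := fun i => decide (v i = 0)

theorem card_filter_zeroPattern_eq {n : ℕ} (a : Fin n → Bool) :
    (Finset.univ.filter fun v : Fin n → ZMod 3 => zeroPattern v = a).card =
      2 ^ (n - weight a) := by
  have hfiber : (Finset.univ.filter fun v : Fin n → ZMod 3 => zeroPattern v = a) =
      Fintype.piFinset fun i => Finset.univ.filter fun c : ZMod 3 => decide (c = 0) = a i := by
    ext v
    simp [zeroPattern, funext_iff]
  have hcard : ∀ b : Bool, (Finset.univ.filter fun c : ZMod 3 => decide (c = 0) = b).card =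
      if b = true then 1 else 2 := by decide
  have hcompl : (Finset.univ.filter fun i => ¬ a i = true).card = n - weight a := by
    have h := Finset.card_filter_add_card_filter_not (s := Finset.univ) (fun i => a i = true)
    rw [Finset.card_univ, Fintype.card_fin] at h
    unfold weight
    omega
  rw [hfiber, Fintype.card_piFinset]
  simp only [hcard]
  rw [Finset.prod_ite, Finset.prod_const_one, one_mul, Finset.prod_const, hcompl]

theorem SunflowerFree.isCapset_filter_zeroPattern {n : ℕ} {A : Finset (Fin n → Bool)}
    (hA : SunflowerFree A) :
    IsCapset (Finset.univ.filter fun v : Fin n → ZMod 3 => zeroPattern v ∈ A) := by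
  intro x hx y hy z hz h
  simp only [Finset.mem_filter, Finset.mem_univ, true_and] at hx hy hz
  have hsunflower : ∀ a b c : ZMod 3, a + b + c = 0 →
      ({decide (a = 0), decide (b = 0), decide (c = 0)} : Multiset Bool) = {false, false, false} ∨
      ({decide (a = 0), decide (b = 0), decide (c = 0)} : Multiset Bool) = {true, true, true} ∨
      ({decide (a = 0), decide (b = 0), decide (c = 0)} : Multiset Bool) = {false, false, true} := by
    decide
  have hequal : ∀ a b c : ZMod 3, a + b + c = 0 → decide (a = 0) = decide (b = 0) →
      decide (b = 0) = decide (c = 0) → a = b ∧ b = c := by decide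
  have hpattern : zeroPattern x = zeroPattern y ∧ zeroPattern y = zeroPattern z := by
    by_contra hne
    exact hA ⟨_, hx, _, hy, _, hz, hne, fun i => hsunflower _ _ _ (congrFun h i)⟩
  have key := fun i => hequal _ _ _ (congrFun h i) (congrFun hpattern.1 i) (congrFun hpattern.2 i)
  exact ⟨funext fun i => (key i).1, funext fun i => (key i).2⟩

theorem card_mul_two_pow_le_capsetMax {n k : ℕ} {A : Finset (Fin n → Bool)}
    (hw : ∀ x ∈ A, weight x = k) (hA : SunflowerFree A) :
    A.card * 2 ^ (n - k) ≤ capsetMax n := by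
  refine le_trans (le_of_eq ?_) hA.isCapset_filter_zeroPattern.card_le_capsetMax
  rw [Finset.card_eq_sum_card_fiberwise (f := zeroPattern) (t := A)
    (s := Finset.univ.filter fun v => zeroPattern v ∈ A)
    (fun v hv => by simpa using hv), ← smul_eq_mul, ← Finset.sum_const]
  refine Finset.sum_congr rfl fun a ha => ?_
  rw [← hw a ha, ← card_filter_zeroPattern_eq a, Finset.filter_filter]
  congr 1
  ext v
  simp only [Finset.mem_filter, Finset.mem_univ, true_and]
  exact ⟨fun h => ⟨h ▸ ha, h⟩, fun h => h.2⟩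

theorem sunflowerFree_fixed_weight_capacity_bound {n k : ℕ} (hn : 1 ≤ n) (hk : k ≤ n)
    (A : Finset (Fin n → Bool)) (hw : ∀ x ∈ A, weight x = k)
    (hA : SunflowerFree A) :
    (A.card : ℝ) ≤ capsetCapacity ^ n / 2 ^ (n - k) := by
  rw [le_div_iff₀ (by positivity)]
  refine le_trans ?_ (capsetMax_le_capsetCapacity_pow hn)
  exact_mod_cast card_mul_two_pow_le_capsetMax hw hA
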